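/- Let P : ℝ² → B(H) be a continuous map, 2π-periodic in each variable, such that each P(k) is an orthogonal projection of constant finite rank on a complex separable Hilbert space H. Then there exists a continuous map U : [−π,π] × ℝ → U(H), 2π-periodic in the second variable, such that P(t,k₂) = U(t,k₂) P(0,0) U(t,k₂)⁻¹ for all (t,k₂) ∈ [−π,π] × ℝ. Moreover, if T is an antiunitary operator with T² = −Id satisfying T∘P(k₁,k₂) = P(−k₁,−k₂)∘T for all (k₁,k₂), then U can be chosen so that additionally T∘U(t,k₂) = U(−t,−k₂)∘T for all (t,k₂) ∈ [−π,π] × ℝ. -/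

import Mathlib

open scoped Real
open Complex

noncomputable section

section CStar

variable {A : Type*} [CStarAlgebra A]

lemma abs_le_norm_of_mem_spectrum {a : A} {x : ℝ} (hx : x ∈ spectrum ℝ a) : |x| ≤ ‖a‖ := by
  rcases subsingleton_or_nontrivial A with _ | _
  · simp [spectrum.of_subsingleton] at hx
  · exact spectrum.norm_le_norm_of_mem hx

/-- The real function `x ↦ 1 / √x`, cut off so as to be continuous on the whole line. -/
def invSqrtCutoff (x : ℝ) : ℝ := (√(max x 2⁻¹))⁻¹

lemma continuous_invSqrtCutoff : Continuous invSqrtCutoff := by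
  unfold invSqrtCutoff
  refine Continuous.inv₀ (by fun_prop) fun x => ?_
  have : (0 : ℝ) < max x 2⁻¹ := lt_max_of_lt_right (by norm_num)
  positivity

/-- The Kato–Nagy unitary attached to two nearby projections; it conjugates `q` into `p`. -/
def katoNagy (p q : A) : A :=
  (p * q + (1 - p) * (1 - q)) * cfc invSqrtCutoff (1 - (p - q) ^ 2)

lemma isSelfAdjoint_one_sub_sq {p q : A} (hp : IsSelfAdjoint p) (hq : IsSelfAdjoint q) :
    IsSelfAdjoint (1 - (p - q) ^ 2) :=
  (IsSelfAdjoint.one A).sub ((hp.sub hq).pow 2)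

lemma commute_one_sub_sq_left {p q : A} (hp : IsIdempotentElem p) (hq : IsIdempotentElem q) :
    Commute (1 - (p - q) ^ 2) p := by
  have e : 1 - (p - q) ^ 2 = 1 - p - q + p * q + q * p := by
    rw [pow_two, sub_mul, mul_sub, mul_sub, hp.eq, hq.eq]; abel
  rw [e]
  simp only [commute_iff_eq, add_mul, sub_mul, mul_add, mul_sub, one_mul, mul_one, hp.eq,
    ← mul_assoc]
  simp only [mul_assoc, hp.eq]
  abel

lemma commute_one_sub_sq_right {p q : A} (hp : IsIdempotentElem p) (hq : IsIdempotentElem q) :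
    Commute (1 - (p - q) ^ 2) q := by
  have := commute_one_sub_sq_left hq hp
  rwa [← neg_sub p q, neg_sq] at this

lemma star_mul_self_of_projections {p q : A} (hp : IsSelfAdjoint p) (hq : IsSelfAdjoint q)
    (hp2 : IsIdempotentElem p) (hq2 : IsIdempotentElem q) :
    star (p * q + (1 - p) * (1 - q)) * (p * q + (1 - p) * (1 - q)) = 1 - (p - q) ^ 2 := by
  simp only [star_add, star_mul, star_sub, star_one, hp.star_eq, hq.star_eq]
  have h1 : p * (1 - p) = 0 := by rw [mul_sub, mul_one, hp2.eq, sub_self]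
  have h2 : (1 - p) * p = 0 := by rw [sub_mul, one_mul, hp2.eq, sub_self]
  have h3 : (1 - p) * (1 - p) = 1 - p := hp2.one_sub.eq
  calc (q * p + (1 - q) * (1 - p)) * (p * q + (1 - p) * (1 - q))
      = q * (p * p) * q + q * (p * (1 - p)) * (1 - q) + (1 - q) * ((1 - p) * p) * q
        + (1 - q) * ((1 - p) * (1 - p)) * (1 - q) := by noncomm_ring
    _ = q * p * q + (1 - q) * (1 - p) * (1 - q) := by rw [h1, h2, h3, hp2.eq]; simp
    _ = 1 - p - q + p * q + q * p + (q * q - q) := by noncomm_ring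
    _ = 1 - (p * p - p * q - q * p + q * q) := by rw [hp2.eq, hq2.eq]; abel
    _ = 1 - (p - q) ^ 2 := by noncomm_ring

lemma katoNagy_mul {p q : A} (hp : IsIdempotentElem p) (hq : IsIdempotentElem q)
    (hps : IsSelfAdjoint p) (hqs : IsSelfAdjoint q) :
    katoNagy p q * q = p * katoNagy p q := by
  have hc : Commute (cfc invSqrtCutoff (1 - (p - q) ^ 2)) q :=
    (isSelfAdjoint_one_sub_sq hps hqs).commute_cfc (commute_one_sub_sq_right hp hq) _
  have h1 : p * (1 - p) = 0 := by rw [mul_sub, mul_one, hp.eq, sub_self]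
  have h2 : (1 - q) * q = 0 := by rw [sub_mul, one_mul, hq.eq, sub_self]
  unfold katoNagy
  rw [mul_assoc, hc.eq, ← mul_assoc, ← mul_assoc]
  congr 1
  rw [add_mul, mul_add, mul_assoc p q q, hq.eq, mul_assoc (1 - p), h2, ← mul_assoc p p,
    hp.eq, ← mul_assoc p (1 - p), h1]
  simp

lemma katoNagy_mem_unitary {p q : A} (hp : IsIdempotentElem p) (hq : IsIdempotentElem q)
    (hps : IsSelfAdjoint p) (hqs : IsSelfAdjoint q) (h : ‖p - q‖ ≤ 1 / 2) :
    katoNagy p q ∈ unitary A := by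
  set d : A := 1 - (p - q) ^ 2 with hd
  set g : A := p * q + (1 - p) * (1 - q) with hg
  set r : A := cfc invSqrtCutoff d with hr
  have hds : IsSelfAdjoint d := isSelfAdjoint_one_sub_sq hps hqs
  have hrs : IsSelfAdjoint r := cfc_predicate _ _
  have hspec : ∀ x ∈ spectrum ℝ d, (2⁻¹ : ℝ) ≤ x := by
    intro x hx
    have hx' : 1 - x ∈ spectrum ℝ ((p - q) ^ 2) := by
      have e : (p - q) ^ 2 = algebraMap ℝ A 1 - d := by simp [hd]
      rw [e, ← spectrum.singleton_sub_eq]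
      exact Set.sub_mem_sub rfl hx
    have h1 := abs_le_norm_of_mem_spectrum hx'
    have h2 : ‖(p - q) ^ 2‖ ≤ 1 / 4 := by
      calc _ ≤ ‖p - q‖ ^ 2 := norm_pow_le' _ two_pos
        _ ≤ (1 / 2) ^ 2 := by gcongr
        _ = _ := by norm_num
    have h3 := (abs_le.1 (h1.trans h2)).2
    linarith
  have hrrd : r * r * d = 1 := by
    have hc : ContinuousOn invSqrtCutoff (spectrum ℝ d) := continuous_invSqrtCutoff.continuousOn
    have hid : d = cfc (id : ℝ → ℝ) d := (cfc_id ℝ d).symm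
    calc r * r * d = cfc (fun x => invSqrtCutoff x * invSqrtCutoff x * id x) d := by
          rw [cfc_mul (fun x => invSqrtCutoff x * invSqrtCutoff x) id d (hc.mul hc) continuousOn_id,
            cfc_mul _ _ d hc hc, ← hid]
      _ = cfc (fun _ => (1 : ℝ)) d := by
          refine cfc_congr fun x hx => ?_
          have hx := hspec x hx
          have : 0 < x := by linarith
          simp only [invSqrtCutoff, max_eq_left hx, id]
          rw [← mul_inv, Real.mul_self_sqrt this.le, inv_mul_cancel₀ this.ne']
      _ = 1 := cfc_const_one ℝ d
  have hdr : ∀ x, Commute d x → Commute r x := fun x hx => hds.commute_cfc hx _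
  have hgg : star g * g = d := star_mul_self_of_projections hps hqs hp hq
  have hgg' : g * star g = d := by
    have := star_mul_self_of_projections hqs hps hq hp
    rw [← neg_sub p q, neg_sq, ← hd] at this
    rw [← this]
    simp only [hg, star_add, star_mul, star_sub, star_one, hps.star_eq, hqs.star_eq]
  have hdg : Commute d g := by
    calc d * g = g * star g * g := by rw [hgg']
      _ = g * d := by rw [mul_assoc, hgg]
  have hrd : Commute r d := hdr d (Commute.refl d)
  change g * r ∈ unitary A
  rw [Unitary.mem_iff]
  constructor
  · rw [star_mul, hrs.star_eq, mul_assoc, ← mul_assoc (star g), hgg, ← hrd.eq, ← mul_assoc, hrrd]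
  · have hdg' : Commute d (star g) := by
      have := hdg.star_star
      rwa [hds.star_eq] at this
    calc g * r * star (g * r) = (g * r) * (r * star g) := by rw [star_mul, hrs.star_eq]
      _ = (r * g) * (star g * r) := by rw [(hdr g hdg).eq, (hdr _ hdg').eq]
      _ = r * (g * star g * r) := by simp only [mul_assoc]
      _ = 1 := by rw [hgg', ← hrd.eq, ← mul_assoc, hrrd]

lemma Continuous.katoNagy {X : Type*} [TopologicalSpace X] {p q : X → A} (hp : Continuous p)
    (hq : Continuous q) (hps : ∀ x, IsSelfAdjoint (p x)) (hqs : ∀ x, IsSelfAdjoint (q x)) :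
    Continuous fun x => katoNagy (p x) (q x) := by
  unfold _root_.katoNagy
  refine Continuous.mul (by fun_prop) ?_
  exact Continuous.cfc_of_mem_nhdsSet (s := Set.univ) _ Filter.univ_mem (by fun_prop)
    (fun x => isSelfAdjoint_one_sub_sq (hps x) (hqs x)) continuous_invSqrtCutoff.continuousOn

lemma map_katoNagy (Φ : A →⋆ₐ[ℝ] A) (hΦ : Continuous Φ) {p q : A} (hps : IsSelfAdjoint p)
    (hqs : IsSelfAdjoint q) : Φ (katoNagy p q) = katoNagy (Φ p) (Φ q) := by
  have h := isSelfAdjoint_one_sub_sq hps hqs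
  have h' := Φ.map_cfc invSqrtCutoff (1 - (p - q) ^ 2) continuous_invSqrtCutoff.continuousOn hΦ h
    (h.map Φ)
  simp [katoNagy, h']

/-- The ordered product of the Kato–Nagy unitaries along the first `j` of `n` equal steps from
`(0, k.2)` to `k`. -/
def katoNagyProd (P : ℝ × ℝ → A) (n : ℕ) : ℕ → ℝ × ℝ → A
  | 0, _ => 1
  | j + 1, k => katoNagy (P ((j + 1 : ℕ) / n * k.1, k.2)) (P ((j : ℕ) / n * k.1, k.2)) *
      katoNagyProd P n j k

lemma exists_uniform_step (P : ℝ × ℝ → A) (hcont : Continuous P)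
    (hper : ∀ k : ℝ × ℝ, P (k.1, k.2 + 2 * π) = P k) (r : ℝ) :
    ∃ δ > 0, ∀ s ∈ Set.Icc (-r) r, ∀ t ∈ Set.Icc (-r) r, |s - t| < δ →
      ∀ y : ℝ, ‖P (s, y) - P (t, y)‖ ≤ 1 / 2 := by
  have hK : IsCompact (Set.Icc (-r) r ×ˢ Set.Icc (0 : ℝ) (2 * π)) :=
    isCompact_Icc.prod isCompact_Icc
  obtain ⟨δ, hδ, h⟩ := Metric.uniformContinuousOn_iff.1
    (hK.uniformContinuousOn_of_continuous hcont.continuousOn) (1 / 2) (by norm_num)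
  refine ⟨δ, hδ, fun s hs t ht hst y => ?_⟩
  have hp : Function.Periodic (fun y => P (s, y) - P (t, y)) (2 * π) := fun y => by
    simp only [hper (s, y), hper (t, y)]
  obtain ⟨z, hz, hyz⟩ := hp.exists_mem_Ico₀ Real.two_pi_pos y
  rw [hyz, ← dist_eq_norm]
  refine (h (s, z) ⟨hs, hz.1, hz.2.le⟩ (t, z) ⟨ht, hz.1, hz.2.le⟩ ?_).le
  simpa [Prod.dist_eq, Real.dist_eq, hδ] using hst

/-- A continuous transport along the first variable, starting from the line `{0} × ℝ`, that is
compatible with every symmetry of the family of projections reversing the parameters. -/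
lemma exists_transport (P : ℝ × ℝ → A) (hcont : Continuous P)
    (hper : ∀ k : ℝ × ℝ, P (k.1, k.2 + 2 * π) = P k)
    (hsa : ∀ k, IsSelfAdjoint (P k)) (hidem : ∀ k, IsIdempotentElem (P k)) :
    ∃ Z : ℝ × ℝ → A, Continuous Z ∧ (∀ k : ℝ × ℝ, Z (k.1, k.2 + 2 * π) = Z k) ∧
      (∀ t ∈ Set.Icc (-π) π, ∀ y : ℝ, Z (t, y) ∈ unitary A ∧
        Z (t, y) * P (0, y) = P (t, y) * Z (t, y)) ∧
      ∀ Φ : A →⋆ₐ[ℝ] A, Continuous Φ → (∀ k, Φ (P k) = P (-k)) → ∀ k, Φ (Z k) = Z (-k) := by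
  obtain ⟨δ, hδ, hstep⟩ := exists_uniform_step P hcont hper π
  obtain ⟨n, hn⟩ := exists_nat_gt (π / δ)
  have hn0 : (0 : ℝ) < n := (div_pos Real.pi_pos hδ).trans hn
  refine ⟨katoNagyProd P n n, ?_, ?_, ?_, ?_⟩
  · suffices ∀ j, Continuous (katoNagyProd P n j) from this n
    intro j
    induction j with
    | zero => exact continuous_const
    | succ j ih =>
      exact (Continuous.katoNagy (hcont.comp (by fun_prop)) (hcont.comp (by fun_prop))
        (fun _ => hsa _) (fun _ => hsa _)).mul ih
  · suffices ∀ j, ∀ k : ℝ × ℝ, katoNagyProd P n j (k.1, k.2 + 2 * π) = katoNagyProd P n j k from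
      this n
    intro j k
    induction j with
    | zero => rfl
    | succ j ih =>
      simp only [katoNagyProd, ih, hper (_, k.2)]
  · intro t ht y
    have key : ∀ j ≤ n, katoNagyProd P n j (t, y) ∈ unitary A ∧
        katoNagyProd P n j (t, y) * P (0, y) =
          P (j / n * t, y) * katoNagyProd P n j (t, y) := by
      intro j hj
      induction j with
      | zero => simp [katoNagyProd, one_mem]
      | succ j ih =>
        obtain ⟨ih1, ih2⟩ := ih (by omega)
        have hmem : ∀ i : ℕ, i ≤ n → (i / n * t : ℝ) ∈ Set.Icc (-π) π := by
          intro i hi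
          have h1 : (i / n : ℝ) ≤ 1 := (div_le_one hn0).2 (by exact_mod_cast hi)
          have h0 : (0 : ℝ) ≤ i / n := by positivity
          rw [Set.mem_Icc, ← abs_le] at ht ⊢
          rw [abs_mul, abs_of_nonneg h0]
          nlinarith [abs_nonneg t]
        have hlt : |((j + 1 : ℕ) / n * t : ℝ) - j / n * t| < δ := by
          have : ((j + 1 : ℕ) / n * t : ℝ) - j / n * t = t / n := by
            push_cast; field_simp; ring
          rw [this, abs_div, abs_of_pos hn0, div_lt_iff₀ hn0]
          rw [Set.mem_Icc, ← abs_le] at ht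
          rw [div_lt_iff₀ hδ] at hn
          linarith
        have hs := hstep _ (hmem (j + 1) hj) _ (hmem j (by omega)) hlt y
        refine ⟨mul_mem (katoNagy_mem_unitary (hidem _) (hidem _) (hsa _) (hsa _) hs) ih1, ?_⟩
        simp only [katoNagyProd]
        rw [mul_assoc, ih2, ← mul_assoc, katoNagy_mul (hidem _) (hidem _) (hsa _) (hsa _),
          mul_assoc]
    have := key n le_rfl
    rwa [div_self hn0.ne', one_mul] at this
  · intro Φ hΦ hP
    suffices ∀ j k, Φ (katoNagyProd P n j k) = katoNagyProd P n j (-k) from this n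
    intro j k
    induction j with
    | zero => simp [katoNagyProd]
    | succ j ih =>
      simp only [katoNagyProd, map_mul, ih, map_katoNagy Φ hΦ (hsa _) (hsa _), hP, Prod.neg_mk,
        Prod.fst_neg, Prod.snd_neg, mul_neg]

lemma exp_mul_eq_of_mul_eq {x a r : A} (h : x * r = a * r) (hr : Commute a r) :
    NormedSpace.exp x * r = NormedSpace.exp a * r := by
  have hpow : ∀ n : ℕ, x ^ n * r = a ^ n * r := by
    intro n
    induction n with
    | zero => simp
    | succ n ih =>
      rw [pow_succ, mul_assoc, h, hr.eq, ← mul_assoc, ih, mul_assoc, ← hr.eq, ← mul_assoc,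
        ← pow_succ]
  have h1 := (NormedSpace.exp_series_hasSum_exp' (𝕂 := ℂ) x).mul_right r
  have h2 := (NormedSpace.exp_series_hasSum_exp' (𝕂 := ℂ) a).mul_right r
  simp only [smul_mul_assoc, hpow] at h1 h2
  exact h1.unique h2

lemma exp_I_smul_cfc_arccos {c : A} (hc : IsSelfAdjoint c) (h : ∀ x ∈ spectrum ℝ c, |x| ≤ 1) :
    NormedSpace.exp (I • cfc Real.arccos c) = c + I • cfc (fun x => √(1 - x ^ 2)) c := by
  have hcn : IsStarNormal c := hc.isStarNormal
  have hspec : ∀ z ∈ spectrum ℂ c, (z.re : ℂ) = z ∧ |z.re| ≤ 1 := by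
    intro z hz
    have hz' := hc.mem_spectrum_eq_re hz
    refine ⟨hz'.symm, h _ ?_⟩
    rw [hz'] at hz
    exact spectrum.algebraMap_mem_iff ℂ |>.1 hz
  have hre : c = cfc (fun z : ℂ => (z.re : ℂ)) c := by
    conv_lhs => rw [← cfc_id ℂ c]
    exact cfc_congr fun z hz => (hspec z hz).1.symm
  have harc : I • cfc Real.arccos c = cfc (fun z : ℂ => I * (Real.arccos z.re : ℂ)) c := by
    rw [cfc_real_eq_complex Real.arccos hc, ← cfc_smul I _ c (by fun_prop)]
    simp only [smul_eq_mul]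
  rw [harc, ← CFC.complex_exp_eq_normedSpace_exp (cfc_predicate _ _),
    ← cfc_comp' Complex.exp _ c (by fun_prop) (by fun_prop), cfc_real_eq_complex _ hc,
    ← cfc_smul I _ c (by fun_prop)]
  conv_rhs => enter [1]; rw [hre]
  rw [← cfc_add c _ _ (by fun_prop) (by fun_prop)]
  refine cfc_congr fun z hz => ?_
  have hz := abs_le.1 (hspec z hz).2
  simp only [smul_eq_mul]
  rw [mul_comm I (Real.arccos z.re : ℂ), Complex.exp_mul_I, ← Complex.ofReal_cos,
    ← Complex.ofReal_sin, Real.cos_arccos hz.1 hz.2, Real.sin_arccos, mul_comm]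

lemma map_cfc_eq_self (Φ : A →⋆ₐ[ℝ] A) (hΦ : Continuous Φ) {a : A} (ha : IsSelfAdjoint a)
    (hΦa : Φ a = a) {f : ℝ → ℝ} (hf : Continuous f) : Φ (cfc f a) = cfc f a := by
  rw [Φ.map_cfc f a hf.continuousOn hΦ ha (ha.map Φ), hΦa]

end CStar

section Hilbert

variable {H : Type*} [NormedAddCommGroup H] [InnerProductSpace ℂ H] [CompleteSpace H]

lemma exists_starProjection_ker (M : H →L[ℂ] H) :
    ∃ R : H →L[ℂ] H, IsSelfAdjoint R ∧ IsIdempotentElem R ∧ M * R = 0 ∧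
      ∀ X : H →L[ℂ] H, M * X = 0 → R * X = X := by
  have : CompleteSpace (LinearMap.ker (M : H →ₗ[ℂ] H)) := M.isClosed_ker.completeSpace_coe
  have hR := isStarProjection_starProjection (U := LinearMap.ker (M : H →ₗ[ℂ] H))
  refine ⟨_, hR.isSelfAdjoint, hR.isIdempotentElem, ?_, fun X hX => ?_⟩
  · ext x
    exact (Submodule.starProjection_apply_mem (LinearMap.ker (M : H →ₗ[ℂ] H)) x)
  · ext x
    refine Submodule.starProjection_eq_self_iff.2 ?_
    exact congr($hX x)

set_option maxHeartbeats 800000 in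
/-- Every unitary operator `u` is of the form `exp (i b)` with `b` self-adjoint, where `b` commutes
with everything that commutes with `u` and is fixed by every conjugate-linear involutive
automorphism that maps `u` to its inverse. -/
lemma exists_selfAdjoint_exp_eq {u : H →L[ℂ] H} (hu : u ∈ unitary (H →L[ℂ] H)) :
    ∃ b : H →L[ℂ] H, IsSelfAdjoint b ∧ NormedSpace.exp (I • b) = u ∧
      (∀ d, Commute d u → Commute d (star u) → Commute d b) ∧
      ∀ Φ : (H →L[ℂ] H) →⋆ₐ[ℝ] (H →L[ℂ] H), Continuous Φ → (∀ x, Φ (I • x) = -(I • Φ x)) →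
        (∀ x, Φ (Φ x) = x) → Φ u = star u → Φ b = b := by
  obtain ⟨hu1, hu2⟩ := Unitary.mem_iff.1 hu
  set c : H →L[ℂ] H := (1 / 2 : ℝ) • (u + star u) with hc
  set s : H →L[ℂ] H := (1 / 2 : ℝ) • (I • (star u - u)) with hs
  have hI : ∀ x : H →L[ℂ] H, I • I • x = -x := fun x => by
    rw [smul_smul, I_mul_I, neg_one_smul]
  have hcs : IsSelfAdjoint c := by
    simp [isSelfAdjoint_iff, hc, add_comm]
  have hss : IsSelfAdjoint s := by
    simp [isSelfAdjoint_iff, hs, ← smul_neg]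
  have hucs : c + I • s = u := by
    rw [hs, smul_comm I, hI, hc, ← smul_add]
    have : u + star u + -(star u - u) = (2 : ℝ) • u := by rw [two_smul]; abel
    rw [this, smul_smul]; norm_num
  have huu : Commute u (star u) := hu2.trans hu1.symm
  have hcomm : Commute c s := by
    have h1 : Commute (u + star u) u := (Commute.refl u).add_left huu.symm
    have h2 : Commute (u + star u) (star u) := huu.add_left (Commute.refl _)
    exact (((h2.sub_right h1).smul_right I).smul_right (1 / 2 : ℝ)).smul_left (1 / 2 : ℝ)
  have hsq : c * c + s * s = 1 := by
    have h1 : c * c = (1 / 4 : ℝ) • ((u + star u) * (u + star u)) := by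
      rw [hc, smul_mul_smul_comm]; norm_num
    have h2 : s * s = -((1 / 4 : ℝ) • ((star u - u) * (star u - u))) := by
      rw [hs, smul_mul_smul_comm, smul_mul_assoc, mul_smul_comm, hI, smul_neg]; norm_num
    have h3 : (u + star u) * (u + star u) - (star u - u) * (star u - u) = (4 : ℝ) • 1 := by
      have : (u + star u) * (u + star u) - (star u - u) * (star u - u)
          = (u * star u + star u * u) + (u * star u + star u * u) := by noncomm_ring
      rw [this, hu1, hu2, show (4 : ℝ) = 1 + 1 + (1 + 1) by norm_num]
      simp only [add_smul, one_smul]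
    rw [h1, h2, ← sub_eq_add_neg, ← smul_sub, h3, smul_smul]; norm_num
  have hnorm : ‖c‖ ≤ 1 := by
    have h1 : ‖u‖ ≤ 1 := by
      have h := CStarRing.norm_star_mul_self (x := u)
      have h' : ‖(1 : H →L[ℂ] H)‖ ≤ 1 := ContinuousLinearMap.norm_id_le
      rw [hu1] at h
      nlinarith [norm_nonneg u]
    calc ‖c‖ ≤ 1 / 2 * (‖u‖ + ‖star u‖) := by
          rw [hc, norm_smul, Real.norm_of_nonneg (by norm_num)]
          gcongr
          exact norm_add_le _ _
      _ ≤ 1 := by rw [norm_star]; linarith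
  have hspec : ∀ x ∈ spectrum ℝ c, |x| ≤ 1 := fun x hx =>
    (abs_le_norm_of_mem_spectrum hx).trans hnorm
  set θ := cfc Real.arccos c with hθ
  set k := cfc (fun x : ℝ => √(1 - x ^ 2)) c with hk
  have hexp : NormedSpace.exp (I • θ) = c + I • k := exp_I_smul_cfc_arccos hcs hspec
  have hθs : IsSelfAdjoint θ := cfc_predicate _ _
  have hks : IsSelfAdjoint k := cfc_predicate _ _
  have hcfc : ∀ (f : ℝ → ℝ) d, Commute c d → Commute (cfc f c) d := fun f d h =>
    hcs.commute_cfc h f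
  have hkk : k * k = s * s := by
    rw [hk, ← cfc_mul _ _ c (by fun_prop) (by fun_prop), eq_sub_of_add_eq' hsq]
    calc _ = cfc (fun x : ℝ => 1 - x * x) c := by
          refine cfc_congr fun x hx => ?_
          have := sq_le_one_iff_abs_le_one x |>.2 (hspec x hx)
          change √(1 - x ^ 2) * √(1 - x ^ 2) = _
          rw [Real.mul_self_sqrt (by linarith), pow_two]
      _ = 1 - c * c := by
          rw [cfc_sub _ _ c (by fun_prop) (by fun_prop), cfc_mul _ _ c (by fun_prop) (by fun_prop),
            cfc_const_one ℝ c, cfc_id' ℝ c]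
  have hks' : Commute k s := hcfc _ _ hcomm
  obtain ⟨r, hrs, hr, hr0, hrX⟩ := exists_starProjection_ker (k - s)
  have hkr : k * r = s * r := by rwa [sub_mul, sub_eq_zero] at hr0
  have hrks : r * (k + s) = k + s := hrX _ (by
    rw [sub_mul, mul_add, mul_add, hkk, hks'.eq]; abel)
  have hcr : ∀ d, Commute d c → Commute d s → Commute d r := by
    have aux : ∀ d, Commute d c → Commute d s → r * (d * r) = d * r := fun d h1 h2 => hrX _ (by
      rw [← mul_assoc, ((hcfc _ _ h1.symm).sub_left h2.symm : Commute (k - s) d).eq, mul_assoc,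
        hr0, mul_zero])
    intro d h1 h2
    have e1 := aux d h1 h2
    have e2 := aux (star d) (by simpa [hcs.star_eq] using h1.star_star)
      (by simpa [hss.star_eq] using h2.star_star)
    have e3 := congr(star $e2)
    simp only [star_mul, star_star, hrs.star_eq] at e3
    rw [commute_iff_eq, ← e1, ← mul_assoc, e3]
  have hrk : Commute r k := ((hcr k (hcfc _ _ (Commute.refl c)) hks')).symm
  have hrθ : Commute r θ := ((hcr θ (hcfc _ _ (Commute.refl c)) (hcfc _ _ hcomm))).symm
  have hrs' : Commute r s := (hcr s hcomm.symm (Commute.refl s)).symm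
  have hjk : k * r - k * (1 - r) = s := by
    rw [mul_add, hrk.eq, hrs'.eq, ← hkr] at hrks
    rw [mul_sub, mul_one, sub_sub_eq_add_sub, hrks, add_sub_cancel_left]
  have hrθ' : r * θ * r = θ * r := by rw [hrθ.eq, mul_assoc, hr.eq]
  have hexp' : NormedSpace.exp (-(I • θ)) = c - I • k := by
    have h := NormedSpace.star_exp (I • θ)
    rw [hexp] at h
    simpa [hθs.star_eq, hcs.star_eq, hks.star_eq, ← sub_eq_add_neg] using h.symm
  refine ⟨(r + r - 1) * θ, ?_, ?_, ?_, ?_⟩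
  · rw [isSelfAdjoint_iff]
    simp only [star_mul, star_sub, star_add, star_one, hrs.star_eq, hθs.star_eq]
    exact ((hrθ.add_left hrθ).sub_left (Commute.one_left θ)).eq.symm
  · have h1 : NormedSpace.exp (I • ((r + r - 1) * θ)) * r = (c + I • k) * r := by
      rw [← hexp]
      refine exp_mul_eq_of_mul_eq ?_ (hrθ.symm.smul_left I)
      rw [smul_mul_assoc, smul_mul_assoc]
      congr 1
      rw [sub_mul, add_mul, one_mul, sub_mul, add_mul, hrθ']
      abel
    have h2 : NormedSpace.exp (I • ((r + r - 1) * θ)) * (1 - r) = (c - I • k) * (1 - r) := by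
      rw [← hexp']
      refine exp_mul_eq_of_mul_eq ?_
        ((Commute.one_right _).sub_right (hrθ.symm.smul_left I).neg_left)
      rw [neg_mul, smul_mul_assoc, smul_mul_assoc, ← smul_neg]
      congr 1
      rw [mul_sub, mul_one, mul_sub, mul_one, sub_mul, add_mul, one_mul, sub_mul, add_mul, hrθ',
        hrθ.eq]
      abel
    calc _ = NormedSpace.exp (I • ((r + r - 1) * θ)) * r
          + NormedSpace.exp (I • ((r + r - 1) * θ)) * (1 - r) := by rw [← mul_add]; simp
      _ = c + I • (k * r - k * (1 - r)) := by
          rw [h1, h2, add_mul, sub_mul, mul_sub c, mul_one, smul_mul_assoc, smul_mul_assoc,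
            smul_sub]
          abel
      _ = u := by rw [hjk, hucs]
  · intro d h1 h2
    have hdc : Commute d c := (h1.add_right h2).smul_right (1 / 2 : ℝ)
    have hds : Commute d s := ((h2.sub_right h1).smul_right I).smul_right (1 / 2 : ℝ)
    have hdr := hcr d hdc hds
    exact ((hdr.add_right hdr).sub_right (Commute.one_right d)).mul_right (hcfc _ _ hdc.symm).symm
  · intro Φ hΦ hΦI hΦΦ hΦu
    have hΦu' : Φ (star u) = u := by rw [map_star, hΦu, star_star]
    have hΦc : Φ c = c := by rw [hc, map_smul, map_add, hΦu, hΦu', add_comm]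
    have hΦs : Φ s = s := by
      rw [hs, map_smul, hΦI, map_sub, hΦu, hΦu', ← smul_neg, neg_sub]
    have hΦk : Φ k = k := map_cfc_eq_self Φ hΦ hcs hΦc (by fun_prop)
    have hΦθ : Φ θ = θ := map_cfc_eq_self Φ hΦ hcs hΦc Real.continuous_arccos
    have hΦks : Φ (k - s) = k - s := by
      rw [map_sub, hΦs, hΦk]
    have h1 : r * Φ r = Φ r := hrX _ (by rw [← hΦks, ← map_mul, hr0, map_zero])
    have hΦr : Φ r = r := by
      have h2 := congr(star $h1)
      rw [star_mul, ← map_star, hrs.star_eq] at h2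
      have h3 := congr(Φ $h1)
      rw [map_mul, hΦΦ] at h3
      exact h2.symm.trans h3
    rw [map_mul, map_sub, map_add, map_one, hΦr, hΦθ]

omit [CompleteSpace H] in
lemma antiunitary_inner_map_map (T : H ≃ₛₗᵢ[starRingEnd ℂ] H) (x y : H) :
    inner ℂ (T x) (T y) = inner ℂ y x := by
  have h1 : I • T y = T (-(I • y)) := by simp [T.map_smulₛₗ]
  have e1 : ‖T x - I • T y‖ = ‖x + I • y‖ := by
    rw [h1, ← map_sub, sub_neg_eq_add, T.norm_map]
  have e2 : ‖T x + I • T y‖ = ‖x - I • y‖ := by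
    rw [h1, ← map_add, ← sub_eq_add_neg, T.norm_map]
  rw [← inner_conj_symm y x, inner_eq_sum_norm_sq_div_four (𝕜 := ℂ) (T x),
    inner_eq_sum_norm_sq_div_four (𝕜 := ℂ) x]
  simp only [← map_add, ← map_sub, T.norm_map, RCLike.I_to_complex, e1, e2]
  simp only [map_div₀, map_add, map_sub, map_mul, map_pow, Complex.coe_algebraMap,
    Complex.conj_ofReal, Complex.conj_I, map_ofNat]
  ring

/-- Conjugation of bounded operators by an antiunitary operator, as a real star algebra
homomorphism. -/
def antiunitaryConj (T : H ≃ₛₗᵢ[starRingEnd ℂ] H) : (H →L[ℂ] H) →⋆ₐ[ℝ] (H →L[ℂ] H) where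
  toFun X := (T.toContinuousLinearEquiv : H →SL[starRingEnd ℂ] H).comp
    (X.comp (T.symm.toContinuousLinearEquiv : H →SL[starRingEnd ℂ] H))
  map_one' := by ext x; simp
  map_mul' X Y := by ext x; simp
  map_zero' := by ext x; simp
  map_add' X Y := by ext x; simp
  commutes' r := by
    ext x
    have h : T (r • T.symm x) = r • x := by
      rw [← Complex.coe_smul, T.map_smulₛₗ, Complex.conj_ofReal, T.apply_symm_apply,
        Complex.coe_smul]
    simp [Algebra.algebraMap_eq_smul_one, h]
  map_star' X := by
    simp only [ContinuousLinearMap.star_eq_adjoint]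
    rw [ContinuousLinearMap.eq_adjoint_iff]
    intro x y
    have h1 := antiunitary_inner_map_map T (X.adjoint (T.symm x)) (T.symm y)
    have h2 := antiunitary_inner_map_map T (T.symm x) (X (T.symm y))
    simp only [LinearIsometryEquiv.apply_symm_apply] at h1 h2
    simp [h1, h2, ContinuousLinearMap.adjoint_inner_right]

lemma antiunitaryConj_apply (T : H ≃ₛₗᵢ[starRingEnd ℂ] H) (X : H →L[ℂ] H) (x : H) :
    antiunitaryConj T X x = T (X (T.symm x)) := rfl

lemma continuous_antiunitaryConj (T : H ≃ₛₗᵢ[starRingEnd ℂ] H) :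
    Continuous (antiunitaryConj T) := by
  refine AddMonoidHomClass.continuous_of_bound (antiunitaryConj T) 1 fun X => ?_
  refine ContinuousLinearMap.opNorm_le_bound _ (by positivity) fun x => ?_
  rw [antiunitaryConj_apply, T.norm_map, one_mul]
  simpa using X.le_opNorm (T.symm x)

end Hilbert

lemma exists_periodic_extension {E : Type*} [TopologicalSpace E] {f : ℝ → E} (hf : Continuous f)
    (h : f (-π) = f π) :
    ∃ V : ℝ → E, Continuous V ∧ Function.Periodic V (2 * π) ∧
      ∀ x ∈ Set.Icc (-π) π, V x = f x := by
  have : Fact (0 < 2 * π) := ⟨Real.two_pi_pos⟩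
  have e : -π + 2 * π = π := by ring
  have h' : f (-π) = f (-π + 2 * π) := by rw [e, h]
  have hV : Function.Periodic (fun x : ℝ => AddCircle.liftIco (2 * π) (-π) f x) (2 * π) := fun x => by
    simp only [AddCircle.coe_add_period]
  refine ⟨_, (AddCircle.liftIco_continuous h' hf.continuousOn).comp
    (AddCircle.continuous_mk' _), hV, fun x hx => ?_⟩
  rcases hx.2.lt_or_eq with hlt | rfl
  · exact AddCircle.liftIco_coe_apply ⟨hx.1, by rwa [e]⟩
  · have h2 := hV (-π)
    rw [e] at h2
    refine h2.trans ((AddCircle.liftIco_coe_apply ⟨le_rfl, ?_⟩).trans h)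
    linarith [Real.pi_pos]

lemma exists_mem_Icc_add_int_mul (x : ℝ) : ∃ y ∈ Set.Icc (-π) π, ∃ n : ℤ, x = y + n * (2 * π) := by
  refine ⟨toIcoMod Real.two_pi_pos (-π) x, ?_, toIcoDiv Real.two_pi_pos (-π) x, ?_⟩
  · have h := toIcoMod_mem_Ico Real.two_pi_pos (-π) x
    exact ⟨h.1, h.2.le.trans (by linarith)⟩
  · rw [← zsmul_eq_mul, toIcoMod_add_toIcoDiv_zsmul]

section Hilbert

variable {H : Type*} [NormedAddCommGroup H] [InnerProductSpace ℂ H] [CompleteSpace H]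

/-- A continuous periodic transport along a closed loop of projections. -/
lemma exists_periodic_transport (Q : ℝ → H →L[ℂ] H) (hcont : Continuous Q)
    (hper : Function.Periodic Q (2 * π)) (hsa : ∀ k, IsSelfAdjoint (Q k))
    (hidem : ∀ k, IsIdempotentElem (Q k)) :
    ∃ V : ℝ → H →L[ℂ] H, Continuous V ∧ Function.Periodic V (2 * π) ∧
      (∀ k, V k ∈ unitary (H →L[ℂ] H) ∧ V k * Q 0 = Q k * V k) ∧
      ∀ Φ : (H →L[ℂ] H) →⋆ₐ[ℝ] (H →L[ℂ] H), Continuous Φ → (∀ x, Φ (I • x) = -(I • Φ x)) →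
        (∀ x, Φ (Φ x) = x) → (∀ k, Φ (Q k) = Q (-k)) → ∀ k, Φ (V k) = V (-k) := by
  let _ : NormedAlgebra ℚ (H →L[ℂ] H) := NormedAlgebra.restrictScalars ℚ ℂ (H →L[ℂ] H)
  obtain ⟨Z, hZc, -, hZ, hZΦ⟩ := exists_transport (fun k : ℝ × ℝ => Q k.1) (by fun_prop)
    (fun _ => rfl) (fun _ => hsa _) (fun _ => hidem _)
  set W : ℝ → H →L[ℂ] H := fun k => Z (k, 0) with hW
  have hWu : ∀ k ∈ Set.Icc (-π) π, W k ∈ unitary (H →L[ℂ] H) := fun k hk => (hZ k hk 0).1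
  have hWQ : ∀ k ∈ Set.Icc (-π) π, W k * Q 0 = Q k * W k := fun k hk => (hZ k hk 0).2
  have hpi := Real.pi_pos
  have hm1 : -π ∈ Set.Icc (-π) π := ⟨le_rfl, by linarith⟩
  have hm2 : π ∈ Set.Icc (-π) π := ⟨by linarith, le_rfl⟩
  have hQπ : Q π = Q (-π) := by
    have := hper (-π)
    rwa [show -π + 2 * π = π by ring] at this
  obtain ⟨u, hu⟩ : ∃ u, u = star (W (-π)) * W π := ⟨_, rfl⟩
  obtain ⟨b, hb, hbu, hbc, hbΦ⟩ := exists_selfAdjoint_exp_eq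
    (hu ▸ mul_mem (Unitary.star_mem (hWu _ hm1)) (hWu _ hm2) : u ∈ unitary (H →L[ℂ] H))
  have huQ : Commute u (Q 0) := by
    have h := congr(star $(hWQ _ hm1))
    rw [star_mul, star_mul, (hsa _).star_eq, (hsa _).star_eq] at h
    rw [commute_iff_eq, hu, mul_assoc, hWQ _ hm2, hQπ, ← mul_assoc, ← h, mul_assoc]
  have huQ' : Commute (star u) (Q 0) := by simpa [(hsa _).star_eq] using huQ.star_star
  have hbQ : Commute b (Q 0) := (hbc _ huQ.symm huQ'.symm).symm
  set X : ℝ → H →L[ℂ] H := fun k => NormedSpace.exp ((-(k / (2 * π))) • (I • b)) with hX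
  have hXc : Continuous X := NormedSpace.exp_continuous.comp (by fun_prop)
  have hXu : ∀ k, X k ∈ unitary (H →L[ℂ] H) := fun k => by
    refine NormedSpace.exp_mem_unitary_of_mem_skewAdjoint ?_
    simp [skewAdjoint.mem_iff, hb.star_eq]
  have hXQ : ∀ k, Commute (X k) (Q 0) := fun k => by
    exact ((hbQ.smul_left I).smul_left _).exp_left
  have hends : W (-π) * X (-π) = W π * X π := by
    have h1 : W π = W (-π) * u := by
      rw [hu, ← mul_assoc, Unitary.mul_star_self_of_mem (hWu _ hm1), one_mul]
    rw [h1, ← hbu, mul_assoc]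
    congr 1
    rw [hX]
    simp only
    rw [← NormedSpace.exp_add_of_commute ((Commute.refl _).smul_right _)]
    congr 1
    have h2 : -(-π / (2 * π)) = 1 + -(π / (2 * π)) := by field_simp; norm_num
    rw [h2, add_smul, one_smul]
  obtain ⟨V, hVc, hVp, hV⟩ := exists_periodic_extension
    (f := fun k => W k * X k) (by fun_prop) hends
  refine ⟨V, hVc, hVp, fun k => ?_, fun Φ hΦ hΦI hΦΦ hΦQ k => ?_⟩
  · obtain ⟨y, hy, n, rfl⟩ := exists_mem_Icc_add_int_mul k
    rw [hVp.int_mul n y, hper.int_mul n y, hV y hy]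
    refine ⟨mul_mem (hWu y hy) (hXu y), ?_⟩
    rw [mul_assoc, (hXQ y).eq, ← mul_assoc, hWQ y hy, mul_assoc]
  · obtain ⟨y, hy, n, rfl⟩ := exists_mem_Icc_add_int_mul k
    have hW' : ∀ k, Φ (W k) = W (-k) := fun k => by
      simpa [hW] using hZΦ Φ hΦ (fun k => hΦQ k.1) (k, 0)
    have hΦb : Φ b = b := hbΦ Φ hΦ hΦI hΦΦ (by
      rw [hu, map_mul, map_star, hW', hW', neg_neg, star_mul, star_star])
    have hX' : Φ (X y) = X (-y) := by
      rw [hX]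
      simp only
      rw [NormedSpace.map_exp Φ hΦ, map_smul, hΦI, hΦb, neg_div, neg_neg, smul_neg, neg_smul,
        neg_neg]
    have hy' : -y ∈ Set.Icc (-π) π := ⟨neg_le_neg hy.2, by linarith [hy.1]⟩
    have e : -(y + n * (2 * π)) = -y + (-n : ℤ) * (2 * π) := by push_cast; ring
    rw [e, hVp.int_mul n y, hVp.int_mul (-n) (-y), hV y hy, hV _ hy', map_mul, hW', hX']

end Hilbert

/-- **Kato–Nagy 2-d construction.** Any continuous, `2π`-periodic (in each variable),
constant-finite-rank projection-valued map on the torus admits a continuous transport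
`U : [−π,π] × ℝ → 𝒰(H)`, periodic in the second variable, intertwining `P (0,0)` with
`P (t,k₂)`; in the presence of a fermionic time-reversal symmetry the transport can
moreover be chosen symmetric. -/
theorem kato_nagy_two_dim
    {H : Type*} [NormedAddCommGroup H] [InnerProductSpace ℂ H] [CompleteSpace H]
    [TopologicalSpace.SeparableSpace H]
    (m : ℕ) (P : ℝ × ℝ → H →L[ℂ] H)
    (hcont : Continuous P)
    (hper₁ : ∀ k : ℝ × ℝ, P (k.1 + 2 * π, k.2) = P k)
    (hper₂ : ∀ k : ℝ × ℝ, P (k.1, k.2 + 2 * π) = P k)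
    (hsa : ∀ k, IsSelfAdjoint (P k))
    (hidem : ∀ k, IsIdempotentElem (P k))
    (hrank : ∀ k, Module.finrank ℂ (LinearMap.range (P k : H →ₗ[ℂ] H)) = m) :
    (∃ U : ℝ × ℝ → H →L[ℂ] H,
      ContinuousOn U (Set.Icc (-π) π ×ˢ Set.univ) ∧
      (∀ t ∈ Set.Icc (-π) π, ∀ k₂ : ℝ, U (t, k₂ + 2 * π) = U (t, k₂)) ∧
      (∀ t ∈ Set.Icc (-π) π, ∀ k₂ : ℝ, U (t, k₂) ∈ unitary (H →L[ℂ] H)) ∧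
      (∀ t ∈ Set.Icc (-π) π, ∀ k₂ : ℝ,
        P (t, k₂) = U (t, k₂) * P (0, 0) * star (U (t, k₂)))) ∧
    (∀ T : H ≃ₛₗᵢ[starRingEnd ℂ] H, (∀ x, T (T x) = -x) →
      (∀ (k : ℝ × ℝ) (x : H), T (P k x) = P (-k) (T x)) →
      ∃ U : ℝ × ℝ → H →L[ℂ] H,
        ContinuousOn U (Set.Icc (-π) π ×ˢ Set.univ) ∧
        (∀ t ∈ Set.Icc (-π) π, ∀ k₂ : ℝ, U (t, k₂ + 2 * π) = U (t, k₂)) ∧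
        (∀ t ∈ Set.Icc (-π) π, ∀ k₂ : ℝ, U (t, k₂) ∈ unitary (H →L[ℂ] H)) ∧
        (∀ t ∈ Set.Icc (-π) π, ∀ k₂ : ℝ,
          P (t, k₂) = U (t, k₂) * P (0, 0) * star (U (t, k₂))) ∧
        (∀ t ∈ Set.Icc (-π) π, ∀ (k₂ : ℝ) (x : H),
          T (U (t, k₂) x) = U (-t, -k₂) (T x))) := by
  have hQ : Continuous fun k => P (0, k) := by fun_prop
  obtain ⟨V, hVc, hVp, hV, hVΦ⟩ := exists_periodic_transport (fun k => P (0, k)) hQ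
    (fun k => hper₂ (0, k)) (fun _ => hsa _) (fun _ => hidem _)
  obtain ⟨Z, hZc, hZp, hZ, hZΦ⟩ := exists_transport P hcont hper₂ hsa hidem
  have hUc : ContinuousOn (fun k : ℝ × ℝ => Z k * V k.2) (Set.Icc (-π) π ×ˢ Set.univ) :=
    Continuous.continuousOn (by fun_prop)
  have hUp : ∀ t ∈ Set.Icc (-π) π, ∀ k₂ : ℝ, Z (t, k₂ + 2 * π) * V (k₂ + 2 * π) =
      Z (t, k₂) * V k₂ := fun t _ k₂ => by rw [hZp (t, k₂), hVp k₂]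
  have hUu : ∀ t ∈ Set.Icc (-π) π, ∀ k₂ : ℝ, Z (t, k₂) * V k₂ ∈ unitary (H →L[ℂ] H) :=
    fun t ht k₂ => mul_mem (hZ t ht k₂).1 (hV k₂).1
  have hUP : ∀ t ∈ Set.Icc (-π) π, ∀ k₂ : ℝ,
      P (t, k₂) = Z (t, k₂) * V k₂ * P (0, 0) * star (Z (t, k₂) * V k₂) := fun t ht k₂ => by
    rw [mul_assoc (Z (t, k₂)), (hV k₂).2, ← mul_assoc, (hZ t ht k₂).2, mul_assoc (P (t, k₂)),
      mul_assoc, Unitary.mul_star_self_of_mem (hUu t ht k₂), mul_one]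
  refine ⟨⟨_, hUc, hUp, hUu, hUP⟩, fun T hT hTP => ⟨_, hUc, hUp, hUu, hUP, fun t ht k₂ x => ?_⟩⟩
  have hTs : ∀ x, T.symm x = -T x := fun x => by
    rw [LinearIsometryEquiv.symm_apply_eq, map_neg, hT, neg_neg]
  have hΦI : ∀ X, antiunitaryConj T (I • X) = -(I • antiunitaryConj T X) := fun X => by
    ext x
    simp [antiunitaryConj_apply, T.map_smulₛₗ]
  have hΦΦ : ∀ X, antiunitaryConj T (antiunitaryConj T X) = X := fun X => by
    ext x
    simp [antiunitaryConj_apply, hTs, hT]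
  have hΦP : ∀ k, antiunitaryConj T (P k) = P (-k) := fun k => by
    ext x
    rw [antiunitaryConj_apply, hTP, LinearIsometryEquiv.apply_symm_apply]
  have hΦ := continuous_antiunitaryConj T
  have h : antiunitaryConj T (Z (t, k₂) * V k₂) = Z (-t, -k₂) * V (-k₂) := by
    rw [map_mul, hZΦ _ hΦ hΦP, hVΦ _ hΦ hΦI hΦΦ (fun k => by simp [hΦP])]
    rfl
  have hx := congr($h (T x))
  rwa [antiunitaryConj_apply, LinearIsometryEquiv.symm_apply_apply] at hx

end
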